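/- Let $q,\kappa_1,\kappa_2,\theta_1,\theta_2,c_1,c_2,c_3,c_4$ be nonzero complex numbers with $\kappa_1\kappa_2c_1c_2c_3c_4=\theta_1\theta_2$, and put $\sigma_1=c_1+c_2+c_3+c_4$, $\sigma_3=c_1c_2c_3+c_1c_2c_4+c_1c_3c_4+c_2c_3c_4$. Let $y,\xi$ be nonzero complex numbers and define $$a=-\kappa_1y+\frac{(y-c_1)(y-c_2)}{y\xi}-\frac{\theta_1}{y},\qquad b=-\kappa_2y+\frac{\kappa_1\kappa_2\xi(y-c_3)(y-c_4)}{y}-\frac{\theta_2}{y},$$ $$\beta=-\frac{\kappa_1\kappa_2\sigma_3+\theta_1b+\theta_2a}{y},\qquad \gamma=\kappa_1b+\kappa_2a+\kappa_1\kappa_2\sigma_1,$$ $$A(z)=\begin{pmatrix}\kappa_1z^2+az+\theta_1&z-y\\ z(\gamma z+\beta)&\kappa_2z^2+bz+\theta_2\end{pmatrix},\qquad B(z)=\begin{pmatrix}z(q\kappa_1-\kappa_2)&q\\-z\beta&q\theta_1-\theta_2\end{pmatrix},$$ $$\Delta=(q\kappa_1-\kappa_2)(q\theta_1-\theta_2)+q\beta,$$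 $$S=-q\kappa_1\kappa_2\theta_1\xi^2(y-c_3)(y-c_4)+\xi\bigl((q^2\kappa_1\theta_1+\kappa_2\theta_2)y^2-q\kappa_1\kappa_2\sigma_3y+2q\theta_1\theta_2\bigr)-q\theta_2(y-c_1)(y-c_2),$$ $$T=-\kappa_1\kappa_2^2\xi^2(y-c_3)(y-c_4)+\xi\bigl(2q\kappa_1\kappa_2y^2-q\kappa_1\kappa_2\sigma_1y+q^2\kappa_1\theta_1+\kappa_2\theta_2\bigr)-q^2\kappa_1(y-c_1)(y-c_2).$$ Assume $T\ne0$ and $\Delta\neq0$, set $\tilde y=S/(yT)$, assume $\tilde y\ne0$, and let $\tilde A_{11}=\bigl[B(q\tilde y)\,A(\tilde y)\,\mathrm{adj}(B(\tilde y))\bigr]_{11}/(\tilde y\Delta)$, where $\mathrm{adj}$ is the $2\times2$ adjugate (this is the $(1,1)$ entry of $B(q\tilde y)A(\tilde y)B(\tilde y)^{-1}$, since $\det B(\tilde y)=\tilde y\Delta$). Then, provided $\tilde A_{11}\neq0$ and the two factors in the denominator below are nonzero, the quantity $\tilde\xi=(\tilde y-c_1)(\tilde y-c_2)/\tilde A_{11}$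 satisfies $$\tilde\xi=\frac{c_1c_2}{q\kappa_1\theta_1\xi}\cdot\frac{\Bigl(\xi\bigl(y-\frac{q\theta_1}{c_1\kappa_2}\bigr)-\frac{q}{\kappa_2}(y-c_2)\Bigr)\Bigl(\xi\bigl(y-\frac{q\theta_1}{c_2\kappa_2}\bigr)-\frac{q}{\kappa_2}(y-c_1)\Bigr)}{\Bigl(\xi(y-c_4)-\frac{q}{\kappa_2}\bigl(y-\frac{\theta_2}{qc_3\kappa_1}\bigr)\Bigr)\Bigl(\xi(y-c_3)-\frac{q}{\kappa_2}\bigl(y-\frac{\theta_2}{qc_4\kappa_1}\bigr)\Bigr)}.$$ -/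

import Mathlib

open Matrix

/-- Factorization into linear factors in `ξ` of the polynomial which equals `(y T)² Ã₁₁`, with
`c1 = θ1 e` so that the relation `κ1 κ2 c1 c2 c3 c4 = θ1 θ2` becomes polynomial in `e`. -/
theorem numerator_factorization (q κ1 κ2 θ1 e c2 c3 c4 y ξ θ2 S T : ℂ)
    (hθ2 : θ2 = κ1 * κ2 * e * c2 * c3 * c4)
    (hS : S = -q * κ1 * κ2 * θ1 * ξ ^ 2 * (y - c3) * (y - c4)
      + ξ * ((q ^ 2 * κ1 * θ1 + κ2 * θ2) * y ^ 2
        - q * κ1 * κ2 * (θ1 * e * c2 * c3 + θ1 * e * c2 * c4 + θ1 * e * c3 * c4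
          + c2 * c3 * c4) * y + 2 * q * θ1 * θ2)
      - q * θ2 * (y - θ1 * e) * (y - c2))
    (hT : T = -κ1 * κ2 ^ 2 * ξ ^ 2 * (y - c3) * (y - c4)
      + ξ * (2 * q * κ1 * κ2 * y ^ 2 - q * κ1 * κ2 * (θ1 * e + c2 + c3 + c4) * y
        + (q ^ 2 * κ1 * θ1 + κ2 * θ2))
      - q ^ 2 * κ1 * (y - θ1 * e) * (y - c2)) :
    q * κ1 * S ^ 2 + θ2 * y ^ 2 * T ^ 2
        + S * T * (κ1 * κ2 * ξ * (y - c3) * (y - c4) - q * κ1 * y ^ 2 - θ2)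
      = q * ξ * κ1 ^ 3
        * (κ2 * ξ * (y - c4) - (q * y - κ2 * e * c2 * c4))
        * (κ2 * ξ * (y - c3) - (q * y - κ2 * e * c2 * c3))
        * (θ1 * κ2 * ξ * (y - c3) * (y - c4) - (y - θ1 * e) * (q * θ1 * y - κ2 * c2 * c3 * c4))
        * (κ2 * ξ * (y - c3) * (y - c4) - (y - c2) * (q * y - κ2 * e * c3 * c4)) := by
  subst hS hT hθ2
  ring

/-- Formula for the transformed coordinate
`ξ̃ = (ỹ - c1)(ỹ - c2)/Ã₁₁`, where `ỹ = S/(yT)` and `Ã₁₁` is the (1,1) entry of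
`B(qỹ) A(ỹ) B(ỹ)⁻¹`. -/
theorem xi_tilde_formula
    (q κ1 κ2 θ1 θ2 c1 c2 c3 c4 : ℂ)
    (hq : q ≠ 0) (hκ1 : κ1 ≠ 0) (hκ2 : κ2 ≠ 0) (hθ1 : θ1 ≠ 0) (hθ2 : θ2 ≠ 0)
    (hc1 : c1 ≠ 0) (hc2 : c2 ≠ 0) (hc3 : c3 ≠ 0) (hc4 : c4 ≠ 0)
    (hrel : κ1 * κ2 * c1 * c2 * c3 * c4 = θ1 * θ2)
    (σ1 σ3 : ℂ)
    (hσ1 : σ1 = c1 + c2 + c3 + c4)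
    (hσ3 : σ3 = c1 * c2 * c3 + c1 * c2 * c4 + c1 * c3 * c4 + c2 * c3 * c4)
    (y ξ : ℂ) (hy : y ≠ 0) (hξ : ξ ≠ 0)
    (a b β γ Δ S T : ℂ)
    (ha : a = -κ1 * y + (y - c1) * (y - c2) / (y * ξ) - θ1 / y)
    (hb : b = -κ2 * y + κ1 * κ2 * ξ * (y - c3) * (y - c4) / y - θ2 / y)
    (hβ : β = -(κ1 * κ2 * σ3 + θ1 * b + θ2 * a) / y)
    (hγ : γ = κ1 * b + κ2 * a + κ1 * κ2 * σ1)
    (hΔ : Δ = (q * κ1 - κ2) * (q * θ1 - θ2) + q * β)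
    (hS : S = -q * κ1 * κ2 * θ1 * ξ ^ 2 * (y - c3) * (y - c4)
      + ξ * ((q ^ 2 * κ1 * θ1 + κ2 * θ2) * y ^ 2 - q * κ1 * κ2 * σ3 * y
        + 2 * q * θ1 * θ2)
      - q * θ2 * (y - c1) * (y - c2))
    (hT : T = -κ1 * κ2 ^ 2 * ξ ^ 2 * (y - c3) * (y - c4)
      + ξ * (2 * q * κ1 * κ2 * y ^ 2 - q * κ1 * κ2 * σ1 * y
        + (q ^ 2 * κ1 * θ1 + κ2 * θ2))
      - q ^ 2 * κ1 * (y - c1) * (y - c2))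
    (A B : ℂ → Matrix (Fin 2) (Fin 2) ℂ)
    (hA : ∀ z : ℂ, A z = !![κ1 * z ^ 2 + a * z + θ1, z - y;
      z * (γ * z + β), κ2 * z ^ 2 + b * z + θ2])
    (hB : ∀ z : ℂ, B z = !![z * (q * κ1 - κ2), q; -z * β, q * θ1 - θ2])
    (hT0 : T ≠ 0) (hΔ0 : Δ ≠ 0)
    (ty : ℂ) (hty : ty = S / (y * T)) (hty0 : ty ≠ 0)
    (A11 : ℂ) (hA11 : A11 = (B (q * ty) * A ty * (B ty).adjugate) 0 0 / (ty * Δ))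
    (hA110 : A11 ≠ 0)
    (hden1 : ξ * (y - c4) - (q / κ2) * (y - θ2 / (q * c3 * κ1)) ≠ 0)
    (hden2 : ξ * (y - c3) - (q / κ2) * (y - θ2 / (q * c4 * κ1)) ≠ 0) :
    (ty - c1) * (ty - c2) / A11
      = (c1 * c2 / (q * κ1 * θ1 * ξ)) *
        ((ξ * (y - q * θ1 / (c1 * κ2)) - (q / κ2) * (y - c2)) *
          (ξ * (y - q * θ1 / (c2 * κ2)) - (q / κ2) * (y - c1))) /
        ((ξ * (y - c4) - (q / κ2) * (y - θ2 / (q * c3 * κ1))) *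
          (ξ * (y - c3) - (q / κ2) * (y - θ2 / (q * c4 * κ1)))) := by
  obtain ⟨e, rfl⟩ : ∃ e, c1 = θ1 * e := ⟨c1 / θ1, by field_simp⟩
  have he : e ≠ 0 := right_ne_zero_of_mul hc1
  have hθ2' : θ2 = κ1 * κ2 * e * c2 * c3 * c4 :=
    mul_left_cancel₀ hθ1 (by linear_combination -hrel)
  have hay : a * (y * ξ) = -κ1 * y ^ 2 * ξ + (y - θ1 * e) * (y - c2) - θ1 * ξ := by
    rw [ha]; field_simp
  have hby : b * y = -κ2 * y ^ 2 + κ1 * κ2 * ξ * (y - c3) * (y - c4) - θ2 := by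
    rw [hb]; field_simp
  have hβy : β * y = -(κ1 * κ2 * σ3 + θ1 * b + θ2 * a) := by
    rw [hβ]; field_simp
  have hSΔ : S = y ^ 2 * ξ * Δ := by
    rw [hS, hΔ]
    linear_combination -q * y * ξ * hβy + q * θ1 * ξ * hby + q * θ2 * hay
  have hTab : T = -(y * ξ) * (q ^ 2 * κ1 * a + κ2 * b + (q * κ1 - κ2) ^ 2 * y
      + q * κ1 * κ2 * σ1) := by
    rw [hT]
    linear_combination q ^ 2 * κ1 * hay + κ2 * ξ * hby
  have htyT : ty * T = Δ * y * ξ := by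
    rw [hty, hSΔ]; field_simp
  obtain ⟨L, hL⟩ : ∃ L, L = (q * κ1 - κ2) * (q * θ1 - θ2) * a - (q * κ1 - κ2) * β * y
      + (q * θ1 - θ2) * γ + β * b := ⟨_, rfl⟩
  have hLST : q * L * y ^ 3 * ξ
      = S * y * (b - (q * κ1 - κ2) * y) - (q * θ1 - θ2) * y ^ 2 * T := by
    rw [hSΔ, hTab, hL, hγ, hΔ]; ring
  have hA11Δ : A11 * Δ = q * (κ1 * Δ * ty ^ 2 + L * ty + θ1 * Δ) := by
    have h : A11 * (ty * Δ) = (B (q * ty) * A ty * (B ty).adjugate) 0 0 := by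
      rw [hA11]; field_simp
    rw [hA, hB, hB, Matrix.adjugate_fin_two_of] at h
    simp only [Matrix.mul_apply, Fin.sum_univ_two, Matrix.of_apply, Matrix.cons_val',
      Matrix.cons_val_zero, Matrix.cons_val_one, Matrix.cons_val_fin_one] at h
    refine mul_left_cancel₀ hty0 ?_
    rw [hL, hΔ]
    rw [hΔ] at h
    linear_combination h
  have hA11T : A11 * T ^ 2 = q * (κ1 * (Δ * y * ξ) ^ 2 + θ1 * T ^ 2 + L * y * ξ * T) := by
    refine mul_left_cancel₀ hΔ0 ?_
    rw [← htyT]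
    linear_combination T ^ 2 * hA11Δ + q * L * T * htyT
  have hfac := numerator_factorization q κ1 κ2 θ1 e c2 c3 c4 y ξ θ2 S T hθ2'
    (by rw [hS, hσ3]) (by rw [hT, hσ1])
  obtain ⟨d1, hd1⟩ : ∃ d, d = κ2 * ξ * (y - c4) - (q * y - κ2 * e * c2 * c4) := ⟨_, rfl⟩
  obtain ⟨d2, hd2⟩ : ∃ d, d = κ2 * ξ * (y - c3) - (q * y - κ2 * e * c2 * c3) := ⟨_, rfl⟩
  obtain ⟨m1, hm1⟩ : ∃ m, m = θ1 * κ2 * ξ * (y - c3) * (y - c4)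
      - (y - θ1 * e) * (q * θ1 * y - κ2 * c2 * c3 * c4) := ⟨_, rfl⟩
  obtain ⟨m2, hm2⟩ : ∃ m, m = κ2 * ξ * (y - c3) * (y - c4)
      - (y - c2) * (q * y - κ2 * e * c3 * c4) := ⟨_, rfl⟩
  obtain ⟨n1, hn1⟩ : ∃ n, n = ξ * (e * κ2 * y - q) - q * e * (y - c2) := ⟨_, rfl⟩
  obtain ⟨n2, hn2⟩ : ∃ n, n = ξ * (c2 * κ2 * y - q * θ1) - q * c2 * (y - θ1 * e) := ⟨_, rfl⟩
  rw [← hd1, ← hd2, ← hm1, ← hm2] at hfac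
  have hA11fac : A11 * (y * T) ^ 2 = q * ξ * κ1 ^ 3 * d1 * d2 * m1 * m2 := by
    rw [← hfac]
    linear_combination y ^ 2 * hA11T + T * hLST + S * T * hby
      - q * κ1 * (S + y ^ 2 * ξ * Δ) * hSΔ
  have hyT : ty * (y * T) = S := by
    rw [hty]; field_simp
  have hc1fac : (ty - θ1 * e) * (y * T) = κ1 * n1 * m1 := by
    rw [sub_mul, hyT, hS, hT, hσ1, hσ3, hn1, hm1, hθ2']; ring
  have hc2fac : (ty - c2) * (y * T) = κ1 * n2 * m2 := by
    rw [sub_mul, hyT, hS, hT, hσ1, hσ3, hn2, hm2, hθ2']; ring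
  have hD1 : ξ * (y - c4) - (q / κ2) * (y - θ2 / (q * c3 * κ1)) = d1 / κ2 := by
    rw [hd1, hθ2']; field_simp
  have hD2 : ξ * (y - c3) - (q / κ2) * (y - θ2 / (q * c4 * κ1)) = d2 / κ2 := by
    rw [hd2, hθ2']; field_simp
  have hN1 : ξ * (y - q * θ1 / (θ1 * e * κ2)) - (q / κ2) * (y - c2) = n1 / (e * κ2) := by
    rw [hn1]; field_simp
  have hN2 : ξ * (y - q * θ1 / (c2 * κ2)) - (q / κ2) * (y - θ1 * e) = n2 / (c2 * κ2) := by
    rw [hn2]; field_simp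
  rw [hD1] at hden1 ⊢
  rw [hD2] at hden2 ⊢
  rw [hN1, hN2]
  have hd1' : d1 ≠ 0 := (div_ne_zero_iff.mp hden1).1
  have hd2' : d2 ≠ 0 := (div_ne_zero_iff.mp hden2).1
  have hyT0 : (y * T) ^ 2 ≠ 0 := pow_ne_zero 2 (mul_ne_zero hy hT0)
  have hRHS : θ1 * e * c2 / (q * κ1 * θ1 * ξ) * (n1 / (e * κ2) * (n2 / (c2 * κ2)))
      / (d1 / κ2 * (d2 / κ2)) = n1 * n2 / (q * κ1 * ξ * d1 * d2) := by
    field_simp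
  rw [hRHS, div_eq_div_iff hA110 (by positivity)]
  refine mul_right_cancel₀ hyT0 ?_
  linear_combination q * κ1 * ξ * d1 * d2 * ((ty - c2) * (y * T) * hc1fac
    + κ1 * n1 * m1 * hc2fac) - n1 * n2 * hA11fac
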